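/- Let (α,β) ∈ LW be renormalisable by finite words ω and ν with ℓ(ω) + ℓ(ν) > 4, 0α ≠ ω ν^∞ and 1β ≠ ν ω^∞. Then (Σ_{(α,β)}, σ) is not topologically transitive. -/

import Mathlib

open Filter MeasureTheory

namespace DoublingHole

/-- One-sided binary sequences (indexed from 0, corresponding to x₁x₂x₃⋯). -/
abbrev Seq : Type := ℕ → Bool

/-- The one-sided shift map σ. -/
def shift (x : Seq) : Seq := fun n => x (n + 1)

/-- Strict lexicographic order ≺ on sequences. -/
def lexLt (x y : Seq) : Prop := ∃ k : ℕ, (∀ i, i < k → x i = y i) ∧ x k < y k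

/-- Reflexive lexicographic order ≼ on sequences. -/
def lexLe (x y : Seq) : Prop := lexLt x y ∨ x = y

/-- The lexicographic subshift Σ_{(α,β)} = {x : β ≼ σⁿx ≼ α for all n ≥ 0}. -/
def lexSubshift (α β : Seq) : Set Seq :=
  {x | ∀ n : ℕ, lexLe β (shift^[n] x) ∧ lexLe (shift^[n] x) α}

/-- The projection π : Σ₂ → [0,1], π(x) = Σ xᵢ 2^{-i}. -/
noncomputable def piMap (x : Seq) : ℝ := ∑' i : ℕ, if x i then (1 : ℝ) / 2 ^ (i + 1) else 0

/-- The mirror image x̄ of a sequence. -/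
def mirror (x : Seq) : Seq := fun n => !(x n)

/-- The set P of Parry sequences: α₁ = 1 and σⁿα ≼ α for all n ≥ 1. -/
def ParryP : Set Seq := {α | α 0 = true ∧ ∀ n, 1 ≤ n → lexLe (shift^[n] α) α}

/-- The set P̄ of mirror images of Parry sequences. -/
def barP : Set Seq := {β | mirror β ∈ ParryP}

/-- Periodic sequences. -/
def PerSet : Set Seq := {x | ∃ k, 1 ≤ k ∧ shift^[k] x = x}

/-- Membership in the lexicographic world LW. -/
def inLW (α β : Seq) : Prop :=
  α ∈ ParryP ∧ β ∈ barP ∧ ∀ n, 1 ≤ n → lexLe β (shift^[n] α) ∧ lexLe (shift^[n] β) α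

/-- The doubling map x ↦ 2x (mod 1) on S¹ identified with [0,1). -/
noncomputable def dbl (x : ℝ) : ℝ := Int.fract (2 * x)

/-- The exceptional set X_{(a,b)} of points whose orbit avoids the hole (a,b). -/
def Xset (a b : ℝ) : Set ℝ :=
  {x | x ∈ Set.Ico (0 : ℝ) 1 ∧ ∀ n : ℕ, dbl^[n] x ∉ Set.Ioo a b}

/-- The attractor Λ_{(a,b)} = [2b-1, 2a] ∩ X_{(a,b)}. -/
def Lam (a b : ℝ) : Set ℝ := Set.Icc (2 * b - 1) (2 * a) ∩ Xset a b

/-- χ(a) = sup{b : X_{(a,b)} is uncountable}. -/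
noncomputable def chiFn (a : ℝ) : ℝ :=
  sSup {b | b ∈ Set.Ico (0 : ℝ) 1 ∧ ¬ (Xset a b).Countable}

/-- The parameter region D₁. -/
def D1 : Set (ℝ × ℝ) :=
  {p | p.1 ∈ Set.Ioo (1/4 : ℝ) (1/2) ∧ p.2 ∈ Set.Ioo (1/2 : ℝ) (3/4) ∧ p.2 ≤ chiFn p.1}

/-- The set S of parameters whose endpoints both fall into the hole. -/
def Sset : Set (ℝ × ℝ) :=
  {p | p ∈ D1 ∧ (∃ n, 1 ≤ n ∧ dbl^[n] p.1 ∈ Set.Ioo p.1 p.2) ∧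
        ∃ m, 1 ≤ m ∧ dbl^[m] p.2 ∈ Set.Ioo p.1 p.2}

/-- The finite word w occurs in (is a factor of) the sequence x. -/
def occursIn (w : List Bool) (x : Seq) : Prop :=
  ∃ i : ℕ, w = List.ofFn fun j : Fin w.length => x (i + (j : ℕ))

/-- The language of a subshift: all finite factors of its elements. -/
def Lang (A : Set Seq) : Set (List Bool) := {w | ∃ x ∈ A, occursIn w x}

/-- A set of sequences is a subshift of finite type if it is defined by
finitely many forbidden words. -/
def IsSFT (A : Set Seq) : Prop :=
  ∃ F : Finset (List Bool), A = {x | ∀ w ∈ F, ¬ occursIn w x}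

/-- B_n(A): the admissible words of length n. -/
def wordsOfLen (A : Set Seq) (n : ℕ) : Set (List Bool) :=
  {w | w.length = n ∧ w ∈ Lang A}

/-- Topological transitivity of a subshift, phrased via its language. -/
def TransitiveShift (A : Set Seq) : Prop :=
  ∀ u ∈ Lang A, ∀ v ∈ Lang A, ∃ t ∈ Lang A, u ++ t ++ v ∈ Lang A

/-- Cyclic rotation of a finite word. -/
def rot (w : List Bool) (k : ℕ) : List Bool := w.drop k ++ w.take k

/-- Lexicographic (dictionary) order on finite words. -/
def listLe (u v : List Bool) : Prop := List.Lex (· < ·) u v ∨ u = v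

/-- w = 0-max_w : w starts with 0 and is the lexicographically largest
cyclic permutation of itself starting with 0. -/
def isZeroMax (w : List Bool) : Prop :=
  w.headD true = false ∧
    ∀ k, k < w.length → (rot w k).headD true = false → listLe (rot w k) w

/-- w = 1-min_w : w starts with 1 and is the lexicographically smallest
cyclic permutation of itself starting with 1. -/
def isOneMin (w : List Bool) : Prop :=
  w.headD false = true ∧
    ∀ k, k < w.length → (rot w k).headD false = true → listLe w (rot w k)

/-- v is the 0-max cyclic permutation of w. -/
def isZeroMaxOf (v w : List Bool) : Prop :=
  (∃ k, k < w.length ∧ v = rot w k) ∧ v.headD true = false ∧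
    ∀ k, k < w.length → (rot w k).headD true = false → listLe (rot w k) v

/-- u is the 1-min cyclic permutation of w. -/
def isOneMinOf (u w : List Bool) : Prop :=
  (∃ k, k < w.length ∧ u = rot w k) ∧ u.headD false = true ∧
    ∀ k, k < w.length → (rot w k).headD false = true → listLe u (rot w k)

/-- The periodic sequence w^∞. -/
def periodicSeq (w : List Bool) : Seq := fun i => w.getD (i % w.length) false

/-- The sequence w followed by x. -/
def wordThen (w : List Bool) (x : Seq) : Seq :=
  fun i => if i < w.length then w.getD i false else x (i - w.length)

/-- Prepend one symbol to a sequence (e.g. 0α, 1β). -/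
def consSeq (a : Bool) (x : Seq) : Seq := fun i => if i = 0 then a else x (i - 1)

/-- A word is balanced if any two factors of equal length have numbers of 1's
differing by at most one. -/
def balanced (w : List Bool) : Prop :=
  ∀ u v : List Bool, u <:+: w → v <:+: w → u.length = v.length →
    ((u.count true : ℤ) - (v.count true : ℤ)).natAbs ≤ 1

/-- A word is cyclically balanced if its square is balanced. -/
def cycBalanced (w : List Bool) : Prop := balanced (w ++ w)

/-- Infinite concatenation of a sequence of (nonempty) finite words. -/
noncomputable def concatSeq (b : ℕ → List Bool) : Seq := fun i =>
  (b (sInf {n : ℕ | i < ∑ k ∈ Finset.range (n + 1), (b k).length})).getD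
    (i - ∑ k ∈ Finset.range (sInf {n : ℕ | i < ∑ k ∈ Finset.range (n + 1), (b k).length}), (b k).length)
    false

/-- (α,β) is renormalisable by the finite words ω and ν:
ω = 0-max_ω, ν = 1-min_ν, (0-max_ν)^∞ ≺ ω^∞, ν^∞ ≺ (1-min_ω)^∞, ℓ(ων) ≥ 3, and
0α = ω ν^{n₁^ν} ω^{n₁^ω} ν^{n₂^ν} ⋯ and 1β = ν ω^{m₁^ω} ν^{m₁^ν} ⋯ with all
exponents in ℕ ∪ {∞}; equivalently 0α (resp. 1β) is an infinite concatenation of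
copies of ω and ν whose first two blocks are ω, ν (resp. ν, ω). -/
def RenormalisableBy (α β : Seq) (ω ν : List Bool) : Prop :=
  isZeroMax ω ∧ isOneMin ν ∧
  (∀ v, isZeroMaxOf v ν → lexLt (periodicSeq v) (periodicSeq ω)) ∧
  (∀ u, isOneMinOf u ω → lexLt (periodicSeq ν) (periodicSeq u)) ∧
  3 ≤ ω.length + ν.length ∧
  (∃ b : ℕ → List Bool, b 0 = ω ∧ b 1 = ν ∧ (∀ k, b k = ω ∨ b k = ν) ∧
    consSeq false α = concatSeq b) ∧
  (∃ c : ℕ → List Bool, c 0 = ν ∧ c 1 = ω ∧ (∀ k, c k = ω ∨ c k = ν) ∧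
    consSeq true β = concatSeq c)

/-- (α,β) is renormalisable by an infinite sequence: either 0α = ω and 1β = νω
with ω infinite and ν = 1-min_ν finite, or 0α = ων and 1β = ν with ν infinite
and ω = 0-max_ω finite. -/
def RenormInfBy (α β : Seq) : Prop :=
  (∃ ν : List Bool, isOneMin ν ∧ consSeq true β = wordThen ν (consSeq false α)) ∨
  (∃ ω : List Bool, isZeroMax ω ∧ consSeq false α = wordThen ω (consSeq true β))

/-- n_α = min{n ≥ 1 : σⁿα ≻ α}. -/
noncomputable def nAlpha (α : Seq) : ℕ := sInf {n | 1 ≤ n ∧ lexLt α (shift^[n] α)}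

/-- The periodic sequence (α₁ ⋯ α_{n-1} 0)^∞. -/
def cutZero (α : Seq) (n : ℕ) : Seq :=
  fun i => if i % n = n - 1 then false else α (i % n)

/-- The periodic sequence (β₁ ⋯ β_{n-1} 1)^∞. -/
def cutOne (β : Seq) (n : ℕ) : Seq :=
  fun i => if i % n = n - 1 then true else β (i % n)

open Classical in
/-- The map ς : Σ₂¹ → Σ₂¹. -/
noncomputable def varsigma (α : Seq) : Seq :=
  if α ∈ ParryP then α else cutZero α (nAlpha α)

/-- The map ς' : Σ₂⁰ → Σ₂⁰, ς'(β) = mirror of ς(β̄). -/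
noncomputable def varsigma' (β : Seq) : Seq := mirror (varsigma (mirror β))

/-- M_α(β) = min{m ≥ 1 : σ^m β ≻ α}. -/
noncomputable def Msub (α β : Seq) : ℕ := sInf {m | 1 ≤ m ∧ lexLt α (shift^[m] β)}

/-- N_β(α) = min{n ≥ 1 : σⁿ α ≺ β}. -/
noncomputable def Nsub (α β : Seq) : ℕ := sInf {n | 1 ≤ n ∧ lexLt (shift^[n] α) β}

/-- ι(α) = (α₁ ⋯ α_{N_β(α)-1} 0)^∞. -/
noncomputable def iotaA (α β : Seq) : Seq := cutZero α (Nsub α β)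

/-- ι(β) = (β₁ ⋯ β_{M_α(β)-1} 1)^∞. -/
noncomputable def iotaB (α β : Seq) : Seq := cutOne β (Msub α β)

/-- ξ_α(β) = (β₁ ⋯ β_{M-1} 1)^∞ with M = M_α(β). -/
noncomputable def xiA (α β : Seq) : Seq := cutOne β (Msub α β)

/-- ξ'_β(α) = (α₁ ⋯ α_{N-1} 0)^∞ with N = N_β(α). -/
noncomputable def xiB (α β : Seq) : Seq := cutZero α (Nsub α β)

/-- A two sided extremal pair. -/
def twoSidedExtremal (α β : Seq) : Prop :=
  (∃ n, 1 ≤ n ∧ lexLt α (shift^[n] β)) ∧ (∃ m, 1 ≤ m ∧ lexLt (shift^[m] α) β)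

/-- A right extremal pair. -/
def rightExtremal (α β : Seq) : Prop :=
  (∀ m, 1 ≤ m → lexLt β (shift^[m] α)) ∧ (∃ n, 1 ≤ n ∧ lexLt α (shift^[n] β))

/-- A left extremal pair. -/
def leftExtremal (α β : Seq) : Prop :=
  (∀ n, 1 ≤ n → lexLt (shift^[n] β) α) ∧ (∃ m, 1 ≤ m ∧ lexLt (shift^[m] α) β)

/-- Dyadic rationals. -/
def IsDyadic (t : ℝ) : Prop := ∃ (z : ℤ) (n : ℕ), t = (z : ℝ) / 2 ^ n

/-- α₁ ⋯ α_n 1^∞. -/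
def onesAfter (α : Seq) (n : ℕ) : Seq := fun i => if i < n then α i else true

end DoublingHole

namespace DoublingHole

/-! ### The shift and the lexicographic order -/

lemma shift_iterate_apply (x : Seq) (n i : ℕ) : shift^[n] x i = x (n + i) := by
  induction n generalizing x with
  | zero => simp
  | succ n ih =>
    rw [Function.iterate_succ_apply, ih]
    simp only [shift]
    congr 1
    omega

lemma shift_iterate_add (x : Seq) (m n : ℕ) : shift^[m] (shift^[n] x) = shift^[n + m] x := by
  rw [← Function.iterate_add_apply, add_comm]

lemma lexLt_iff (x y : Seq) : lexLt x y ↔ toLex x < toLex y := Iff.rfl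

lemma lexLe_iff (x y : Seq) : lexLe x y ↔ toLex x ≤ toLex y := by
  rw [le_iff_lt_or_eq, lexLe, lexLt_iff, toLex_inj]
  exact Iff.rfl

lemma lexLe.trans {x y z : Seq} (h : lexLe x y) (h' : lexLe y z) : lexLe x z := by
  rw [lexLe_iff] at *
  exact h.trans h'

lemma lexLe.trans_lt {x y z : Seq} (h : lexLe x y) (h' : lexLt y z) : lexLt x z := by
  rw [lexLe_iff] at h
  rw [lexLt_iff] at *
  exact h.trans_lt h'

lemma lexLt.trans_le {x y z : Seq} (h : lexLt x y) (h' : lexLe y z) : lexLt x z := by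
  rw [lexLe_iff] at h'
  rw [lexLt_iff] at *
  exact h.trans_le h'

lemma lexLt_irrefl (x : Seq) : ¬ lexLt x x := by
  rw [lexLt_iff]
  exact lt_irrefl _

lemma lexLt_of_head {x y : Seq} (hx : x 0 = false) (hy : y 0 = true) : lexLt x y :=
  ⟨0, by simp, by simp [hx, hy]⟩

lemma lexLe.head_eq_false {x y : Seq} (h : lexLe x y) (hy : y 0 = false) : x 0 = false := by
  by_contra hx
  exact lexLt_irrefl x (h.trans_lt (lexLt_of_head hy (by simpa using hx)))

lemma lexLe.head_eq_true {x y : Seq} (h : lexLe x y) (hx : x 0 = true) : y 0 = true := by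
  by_contra hy
  exact lexLt_irrefl x (h.trans_lt (lexLt_of_head (by simpa using hy) hx))

lemma lexLt_shift_iff {x y : Seq} {n : ℕ} (h : ∀ i < n, x i = y i) :
    lexLt (shift^[n] x) (shift^[n] y) ↔ lexLt x y := by
  constructor
  · rintro ⟨k, hk, hlt⟩
    simp only [shift_iterate_apply] at hk hlt
    refine ⟨n + k, fun i hi => ?_, hlt⟩
    rcases lt_or_ge i n with hin | hin
    · exact h i hin
    · have := hk (i - n) (by omega)
      rwa [Nat.add_sub_cancel' hin] at this
  · rintro ⟨k, hk, hlt⟩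
    have hnk : n ≤ k := by
      by_contra hc
      exact hlt.ne (h k (by omega))
    refine ⟨k - n, fun i hi => ?_, ?_⟩
    · simp only [shift_iterate_apply]
      exact hk _ (by omega)
    · simpa only [shift_iterate_apply, Nat.add_sub_cancel' hnk] using hlt

lemma lexLe_shift_iff {x y : Seq} {n : ℕ} (h : ∀ i < n, x i = y i) :
    lexLe (shift^[n] x) (shift^[n] y) ↔ lexLe x y := by
  unfold lexLe
  rw [lexLt_shift_iff h]
  refine or_congr_right ⟨fun he => funext fun i => ?_, fun he => by rw [he]⟩
  rcases lt_or_ge i n with hin | hin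
  · exact h i hin
  · have := congrFun he (i - n)
    rwa [shift_iterate_apply, shift_iterate_apply, Nat.add_sub_cancel' hin] at this

lemma lexLe_tail_iff {x y : Seq} (h : x 0 = y 0) : lexLe (shift x) (shift y) ↔ lexLe x y :=
  lexLe_shift_iff (n := 1) fun i hi => by
    obtain rfl : i = 0 := by omega
    exact h

lemma eq_of_lexLe_of_lexLe {x y z : Seq} {n : ℕ} (hxz : lexLe x z) (hzy : lexLe z y)
    (h : ∀ i < n, x i = y i) : ∀ i < n, z i = x i := by
  intro i hi
  rcases hxz with ⟨k, hk, hlt⟩ | rfl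
  · rcases lt_or_ge i k with hik | hik
    · exact (hk i hik).symm
    exfalso
    have hkn := h k (by omega)
    rcases hzy with ⟨l, hl, hlt'⟩ | rfl
    · rcases lt_trichotomy l k with hlk | rfl | hlk
      · rw [← hk l hlk, h l (by omega)] at hlt'
        exact lt_irrefl _ hlt'
      · rw [← hkn] at hlt'
        exact lt_asymm hlt hlt'
      · rw [hl k hlk, hkn] at hlt
        exact lt_irrefl _ hlt
    · rw [hkn] at hlt
      exact lt_irrefl _ hlt
  · rfl

lemma shift_lexLe_self {y : Seq} (h : y 0 = true) : lexLe (shift y) y := by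
  by_cases hy : ∃ k, y k = false
  · left
    classical
    have hk := Nat.find_spec hy
    have hmin : ∀ i < Nat.find hy, y i = true := fun i hi => by
      simpa using Nat.find_min hy hi
    generalize Nat.find hy = k at hk hmin
    obtain _ | k := k
    · simp [h] at hk
    refine ⟨k, fun i hi => ?_, ?_⟩
    · rw [hmin i (by omega), shift, hmin (i + 1) (by omega)]
    · rw [shift, hk, hmin k (by omega)]
      decide
  · right
    push Not at hy
    funext i
    have h1 := hy i
    have h2 := hy (i + 1)
    simp_all [shift]

lemma self_lexLe_shift {y : Seq} (h : y 0 = false) : lexLe y (shift y) := by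
  by_cases hy : ∃ k, y k = true
  · left
    classical
    have hk := Nat.find_spec hy
    have hmin : ∀ i < Nat.find hy, y i = false := fun i hi => by
      simpa using Nat.find_min hy hi
    generalize Nat.find hy = k at hk hmin
    obtain _ | k := k
    · simp [h] at hk
    refine ⟨k, fun i hi => ?_, ?_⟩
    · rw [hmin i (by omega), shift, hmin (i + 1) (by omega)]
    · rw [shift, hk, hmin k (by omega)]
      decide
  · right
    push Not at hy
    funext i
    have h1 := hy i
    have h2 := hy (i + 1)
    simp_all [shift]

lemma shift_lexLe_of_hole {a y : Seq} (ha : a 0 = false) (hy0 : lexLe y (shift a))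
    (hy : ∀ n, y n = false → lexLe (shift^[n] y) a) (n : ℕ) :
    lexLe (shift^[n] y) (shift a) := by
  induction n with
  | zero => exact hy0
  | succ n ih =>
    rw [Function.iterate_succ_apply']
    have e : shift^[n] y 0 = y n := by simp [shift_iterate_apply]
    cases hn : y n with
    | false => exact (lexLe_tail_iff (by rw [e, hn, ha])).2 (hy n hn)
    | true => exact (shift_lexLe_self (by rw [e, hn])).trans ih

lemma lexLe_shift_of_hole {a y : Seq} (ha : a 0 = true) (hy0 : lexLe (shift a) y)
    (hy : ∀ n, y n = true → lexLe a (shift^[n] y)) (n : ℕ) :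
    lexLe (shift a) (shift^[n] y) := by
  induction n with
  | zero => exact hy0
  | succ n ih =>
    rw [Function.iterate_succ_apply']
    have e : shift^[n] y 0 = y n := by simp [shift_iterate_apply]
    cases hn : y n with
    | true => exact (lexLe_tail_iff (by rw [e, hn, ha])).2 (hy n hn)
    | false => exact ih.trans (self_lexLe_shift (by rw [e, hn]))

lemma shift_iterate_mem_lexSubshift {α β x : Seq} (hx : x ∈ lexSubshift α β) (n : ℕ) :
    shift^[n] x ∈ lexSubshift α β := fun m => by
  rw [shift_iterate_add]
  exact hx _

lemma lexLe_of_mem_lexSubshift {a b x : Seq} (hx : x ∈ lexSubshift (shift a) b)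
    (h : x 0 = a 0) : lexLe x a :=
  (lexLe_tail_iff h).1 (hx 1).2

lemma lexLe_of_mem_lexSubshift' {a b x : Seq} (hx : x ∈ lexSubshift a (shift b))
    (h : b 0 = x 0) : lexLe b x :=
  (lexLe_tail_iff h).1 (hx 1).1

lemma lexSubshift_mono {α β α' β' : Seq} (hα : lexLe α' α) (hβ : lexLe β β') :
    lexSubshift α' β' ⊆ lexSubshift α β := fun _ hx n =>
  ⟨hβ.trans (hx n).1, (hx n).2.trans hα⟩

lemma shift_consSeq (a : Bool) (x : Seq) : shift (consSeq a x) = x := by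
  funext i
  simp [shift, consSeq]

/-! ### Concatenations -/

lemma wordThen_apply_of_lt {w : List Bool} {i : ℕ} (x : Seq) (h : i < w.length) :
    wordThen w x i = w.getD i false := by
  simp [wordThen, h]

lemma shift_wordThen (w : List Bool) (x : Seq) : shift^[w.length] (wordThen w x) = x := by
  funext i
  simp [shift_iterate_apply, wordThen]

lemma eq_wordThen_shift {w : List Bool} {x : Seq} (h : ∀ i < w.length, x i = w.getD i false) :
    x = wordThen w (shift^[w.length] x) := by
  funext i
  by_cases hi : i < w.length
  · rw [wordThen_apply_of_lt _ hi, h i hi]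
  · simp only [wordThen, hi, if_false, shift_iterate_apply]
    congr 1
    omega

lemma wordThen_agree (w : List Bool) (x y : Seq) :
    ∀ i < w.length, wordThen w x i = wordThen w y i := fun i hi => by
  rw [wordThen_apply_of_lt _ hi, wordThen_apply_of_lt _ hi]

lemma lexLe_wordThen_iff {w : List Bool} {x y : Seq} :
    lexLe (wordThen w x) (wordThen w y) ↔ lexLe x y := by
  rw [← lexLe_shift_iff (wordThen_agree w x y), shift_wordThen, shift_wordThen]

lemma periodicSeq_apply_of_lt {w : List Bool} {i : ℕ} (h : i < w.length) :
    periodicSeq w i = w.getD i false := by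
  simp [periodicSeq, Nat.mod_eq_of_lt h]

lemma periodicSeq_length_mul_add (w : List Bool) (m i : ℕ) :
    periodicSeq w (m * w.length + i) = periodicSeq w i := by
  simp [periodicSeq]

lemma wordThen_periodicSeq (w : List Bool) : wordThen w (periodicSeq w) = periodicSeq w := by
  funext i
  by_cases hi : i < w.length
  · rw [wordThen_apply_of_lt _ hi, periodicSeq_apply_of_lt hi]
  · simp only [wordThen, hi, if_false]
    rw [← periodicSeq_length_mul_add w 1 (i - w.length)]
    congr 1
    omega

lemma eq_periodicSeq {w : List Bool} {x : Seq} (hw : 0 < w.length) (h : x = wordThen w x) :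
    x = periodicSeq w := by
  funext i
  induction i using Nat.strong_induction_on with
  | _ i ih =>
    rw [h, ← wordThen_periodicSeq w]
    by_cases hi : i < w.length
    · exact wordThen_agree _ _ _ i hi
    · simp only [wordThen, hi, if_false]
      exact ih _ (by omega)

lemma concatSeq_apply {b : ℕ → List Bool} {i n : ℕ}
    (h1 : ∑ k ∈ Finset.range n, (b k).length ≤ i)
    (h2 : i < ∑ k ∈ Finset.range (n + 1), (b k).length) :
    concatSeq b i = (b n).getD (i - ∑ k ∈ Finset.range n, (b k).length) false := by
  have key : sInf {n : ℕ | i < ∑ k ∈ Finset.range (n + 1), (b k).length} = n := by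
    refine le_antisymm (Nat.sInf_le h2) (le_csInf ⟨n, h2⟩ fun m hm => ?_)
    by_contra hc
    have : ∑ k ∈ Finset.range (m + 1), (b k).length ≤ ∑ k ∈ Finset.range n, (b k).length :=
      Finset.sum_le_sum_of_subset (Finset.range_subset_range.2 (by omega))
    have hm' : i < ∑ k ∈ Finset.range (m + 1), (b k).length := hm
    omega
  simp only [concatSeq, key]

lemma exists_block {b : ℕ → List Bool} (hb : ∀ k, 0 < (b k).length) (i : ℕ) :
    ∃ n, ∑ k ∈ Finset.range n, (b k).length ≤ i ∧
      i < ∑ k ∈ Finset.range (n + 1), (b k).length := by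
  induction i with
  | zero => exact ⟨0, by simp, by simpa using hb 0⟩
  | succ i ih =>
    obtain ⟨n, h1, h2⟩ := ih
    by_cases h : i + 1 < ∑ k ∈ Finset.range (n + 1), (b k).length
    · exact ⟨n, by omega, h⟩
    · refine ⟨n + 1, by omega, ?_⟩
      rw [Finset.sum_range_succ]
      have := hb (n + 1)
      omega

lemma concatSeq_eq_wordThen {b : ℕ → List Bool} (hb : ∀ k, 0 < (b k).length) :
    concatSeq b = wordThen (b 0) (concatSeq fun k => b (k + 1)) := by
  funext i
  by_cases hi : i < (b 0).length
  · rw [wordThen_apply_of_lt _ hi, concatSeq_apply (n := 0) (by simp) (by simpa using hi)]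
    simp
  · simp only [wordThen, hi, if_false]
    obtain ⟨n, h1, h2⟩ := exists_block (fun k => hb (k + 1)) (i - (b 0).length)
    have e : ∀ m, ∑ k ∈ Finset.range (m + 1), (b k).length =
        ∑ k ∈ Finset.range m, (b (k + 1)).length + (b 0).length := fun m =>
      Finset.sum_range_succ' _ _
    rw [concatSeq_apply h1 h2, concatSeq_apply (n := n + 1) (by rw [e]; omega)
      (by rw [e]; omega), e]
    congr 1
    omega

/-- The concatenation of the blocks from the `k`-th one on. -/
noncomputable def concatTail (b : ℕ → List Bool) (k : ℕ) : Seq := concatSeq fun i => b (i + k)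

lemma concatTail_eq_wordThen {b : ℕ → List Bool} (hb : ∀ k, 0 < (b k).length) (k : ℕ) :
    concatTail b k = wordThen (b k) (concatTail b (k + 1)) := by
  rw [concatTail, concatSeq_eq_wordThen fun i => hb (i + k), Nat.zero_add, concatTail]
  simp only [Nat.add_right_comm, Nat.add_assoc]

lemma exists_shift_eq_concatTail {b : ℕ → List Bool} (hb : ∀ k, 0 < (b k).length) (k : ℕ) :
    ∃ t, k ≤ t ∧ concatTail b k = shift^[t] (concatSeq b) := by
  induction k with
  | zero => exact ⟨0, le_rfl, rfl⟩
  | succ k ih =>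
    obtain ⟨t, ht, h⟩ := ih
    refine ⟨t + (b k).length, by have := hb k; omega, ?_⟩
    rw [← shift_iterate_add, ← h, concatTail_eq_wordThen hb k, shift_wordThen]

/-! ### Rotations of finite words -/

lemma periodicSeq_rot {w : List Bool} {k : ℕ} (hk : k < w.length) :
    periodicSeq (rot w k) = shift^[k] (periodicSeq w) := by
  funext i
  have hl : (rot w k).length = w.length := by simp [rot]; omega
  have hi : i % w.length < w.length := Nat.mod_lt _ (by omega)
  rw [shift_iterate_apply, periodicSeq, hl, periodicSeq, Nat.add_mod,
    Nat.mod_eq_of_lt hk]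
  simp only [List.getD_eq_getElem?_getD, rot]
  generalize i % w.length = j at hi
  by_cases hj : j < w.length - k
  · rw [List.getElem?_append_left (by simpa using hj), List.getElem?_drop,
      Nat.mod_eq_of_lt (by omega)]
  · rw [List.getElem?_append_right (by simpa using hj), List.length_drop,
      List.getElem?_take_of_lt (by omega), Nat.mod_eq_sub_mod (by omega),
      Nat.mod_eq_of_lt (by omega)]
    congr 2
    omega

lemma shift_periodicSeq_eq_rot {w : List Bool} (hw : 0 < w.length) (i : ℕ) :
    shift^[i] (periodicSeq w) = periodicSeq (rot w (i % w.length)) := by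
  rw [periodicSeq_rot (Nat.mod_lt _ hw)]
  funext j
  rw [shift_iterate_apply, shift_iterate_apply]
  simp [periodicSeq]

lemma headD_rot {w : List Bool} {i : ℕ} (hw : 0 < w.length) (d : Bool) :
    (rot w (i % w.length)).headD d = periodicSeq w i := by
  have h := congrFun (shift_periodicSeq_eq_rot hw i) 0
  rw [shift_iterate_apply, Nat.add_zero] at h
  rw [h]
  have hl : 0 < (rot w (i % w.length)).length := by
    have := Nat.mod_lt i hw
    simp [rot]; omega
  cases hr : rot w (i % w.length) with
  | nil => simp [hr] at hl
  | cons a t => simp [periodicSeq]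

lemma exists_of_lex {u v : List Bool} (h : List.Lex (· < ·) u v) (hl : u.length = v.length) :
    ∃ k < u.length, (∀ i < k, u.getD i false = v.getD i false) ∧
      u.getD k false < v.getD k false := by
  induction h with
  | nil => simp at hl
  | rel h => exact ⟨0, by simp, by simp, by simpa using h⟩
  | cons _ ih =>
    obtain ⟨k, hk, h1, h2⟩ := ih (by simpa using hl)
    refine ⟨k + 1, by simpa using hk, fun i hi => ?_, by simpa using h2⟩
    cases i with
    | zero => simp
    | succ i => simpa using h1 i (by omega)

lemma periodicSeq_mono {u v : List Bool} (h : listLe u v) (hl : u.length = v.length) :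
    lexLe (periodicSeq u) (periodicSeq v) := by
  rcases h with h | rfl
  · obtain ⟨k, hk, h1, h2⟩ := exists_of_lex h hl
    refine Or.inl ⟨k, fun i hi => ?_, ?_⟩
    · rw [periodicSeq_apply_of_lt (by omega), periodicSeq_apply_of_lt (by omega), h1 i hi]
    · rwa [periodicSeq_apply_of_lt (by omega), periodicSeq_apply_of_lt (by omega)]
  · exact Or.inr rfl

lemma length_rot (w : List Bool) (k : ℕ) : (rot w k).length = w.length := by
  simp only [rot, List.length_append, List.length_drop, List.length_take]
  omega

lemma listLe_iff (u v : List Bool) : listLe u v ↔ u ≤ v := by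
  rw [le_iff_lt_or_eq]
  rfl

lemma isZeroMax.shift_lexLe {w : List Bool} (h : isZeroMax w) {i : ℕ}
    (hi : periodicSeq w i = false) : lexLe (shift^[i] (periodicSeq w)) (periodicSeq w) := by
  have hw : 0 < w.length := by
    rcases w with _ | _
    · simp [isZeroMax] at h
    · simp
  rw [shift_periodicSeq_eq_rot hw]
  exact periodicSeq_mono (h.2 _ (Nat.mod_lt _ hw) (by rw [headD_rot hw, hi])) (length_rot _ _)

lemma isOneMin.lexLe_shift {w : List Bool} (h : isOneMin w) {i : ℕ}
    (hi : periodicSeq w i = true) : lexLe (periodicSeq w) (shift^[i] (periodicSeq w)) := by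
  have hw : 0 < w.length := by
    rcases w with _ | _
    · simp [isOneMin] at h
    · simp
  rw [shift_periodicSeq_eq_rot hw]
  exact periodicSeq_mono (h.2 _ (Nat.mod_lt _ hw) (by rw [headD_rot hw, hi]))
    (length_rot _ _).symm

lemma exists_isZeroMaxOf {w : List Bool} (hw : 0 < w.length) {i : ℕ}
    (hi : periodicSeq w i = false) :
    ∃ v, isZeroMaxOf v w ∧ lexLe (shift^[i] (periodicSeq w)) (periodicSeq v) := by
  classical
  obtain ⟨m, hm, hmax⟩ := Finset.exists_max_image
    ((Finset.range w.length).filter fun k => (rot w k).headD true = false) (rot w)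
    ⟨i % w.length, by simp only [Finset.mem_filter, Finset.mem_range, headD_rot hw, hi,
      Nat.mod_lt _ hw, and_self]⟩
  simp only [Finset.mem_filter, Finset.mem_range] at hm hmax
  have hmax' : ∀ k, k < w.length → (rot w k).headD true = false → listLe (rot w k) (rot w m) :=
    fun k hk h => (listLe_iff _ _).2 (hmax k ⟨hk, h⟩)
  refine ⟨rot w m, ⟨⟨m, hm.1, rfl⟩, hm.2, hmax'⟩, ?_⟩
  rw [shift_periodicSeq_eq_rot hw]
  exact periodicSeq_mono (hmax' _ (Nat.mod_lt _ hw) (by rw [headD_rot hw, hi]))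
    (by rw [length_rot, length_rot])

lemma exists_isOneMinOf {w : List Bool} (hw : 0 < w.length) {i : ℕ}
    (hi : periodicSeq w i = true) :
    ∃ u, isOneMinOf u w ∧ lexLe (periodicSeq u) (shift^[i] (periodicSeq w)) := by
  classical
  obtain ⟨m, hm, hmin⟩ := Finset.exists_min_image
    ((Finset.range w.length).filter fun k => (rot w k).headD false = true) (rot w)
    ⟨i % w.length, by simp only [Finset.mem_filter, Finset.mem_range, headD_rot hw, hi,
      Nat.mod_lt _ hw, and_self]⟩
  simp only [Finset.mem_filter, Finset.mem_range] at hm hmin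
  have hmin' : ∀ k, k < w.length → (rot w k).headD false = true → listLe (rot w m) (rot w k) :=
    fun k hk h => (listLe_iff _ _).2 (hmin k ⟨hk, h⟩)
  refine ⟨rot w m, ⟨⟨m, hm.1, rfl⟩, hm.2, hmin'⟩, ?_⟩
  rw [shift_periodicSeq_eq_rot hw]
  exact periodicSeq_mono (hmin' _ (Nat.mod_lt _ hw) (by rw [headD_rot hw, hi]))
    (by rw [length_rot, length_rot])

lemma exists_uniform_ne {w : List Bool} (hw : 0 < w.length) {y : Seq}
    (h : ∀ i, y ≠ shift^[i] (periodicSeq w)) :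
    ∃ K, ∀ i, ∃ j < K, y j ≠ periodicSeq w (i + j) := by
  have h' : ∀ i, ∃ j, y j ≠ periodicSeq w (i + j) := fun i => by
    simpa [funext_iff, shift_iterate_apply] using h i
  choose f hf using h'
  refine ⟨(Finset.range w.length).sup f + 1, fun i => ⟨f (i % w.length), ?_, ?_⟩⟩
  · exact Nat.lt_succ_of_le (Finset.le_sup (Finset.mem_range.2 (Nat.mod_lt _ hw)))
  · have := hf (i % w.length)
    simpa [periodicSeq] using this

/-! ### Words of the inner subshift -/

/-- The first `k` symbols of `p` followed by `r`. -/
def glue (p : Seq) (k : ℕ) (r : Seq) : Seq := fun i => if i < k then p i else r (i - k)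

lemma shift_glue (p r : Seq) (k n : ℕ) : shift^[k + n] (glue p k r) = shift^[n] r := by
  funext i
  simp only [shift_iterate_apply, glue, show ¬ (k + n + i < k) by omega, if_false]
  congr 1
  omega

/-- If `p ≺ q` split after `k` symbols, then the first `k` symbols of `p` can be continued with
any `r` that starts with `0` and is at least as large as the continuation of `p`. -/
lemma glue_mem_lexSubshift {a b p q r : Seq} {k : ℕ} (hp : p ∈ lexSubshift a b)
    (hq : q ∈ lexSubshift a b) (hr : r ∈ lexSubshift a b) (hpq : ∀ i < k, p i = q i)
    (hqk : q k = true) (hr0 : r 0 = false) (hpr : lexLe (shift^[k] p) r) :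
    glue p k r ∈ lexSubshift a b := by
  have hagree : ∀ i < k, p i = glue p k r i := fun i hi => by simp [glue, hi]
  have hle : lexLe p (glue p k r) := by
    rw [← lexLe_shift_iff hagree]
    simpa [shift_glue] using (shift_glue p r k 0).symm ▸ hpr
  have hge : lexLt (glue p k r) q :=
    ⟨k, fun i hi => by rw [← hagree i hi, hpq i hi], by simp [glue, hr0, hqk]⟩
  intro n
  rcases le_or_gt n k with hn | hn
  · constructor
    · exact (hp n).1.trans ((lexLe_shift_iff fun i hi => hagree i (by omega)).2 hle)
    · refine lexLe.trans ((lexLe_shift_iff fun i hi => ?_).2 (Or.inl hge)) (hq n).2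
      rw [← hagree i (by omega), hpq i (by omega)]
  · obtain ⟨m, rfl⟩ := Nat.exists_eq_add_of_le hn.le
    rw [shift_glue]
    exact hr m

lemma exists_glue_mem {a b p q r : Seq} (hp : p ∈ lexSubshift a b)
    (hq : q ∈ lexSubshift a b) (hr : r ∈ lexSubshift a b) (hpq : lexLt p q) (hr0 : r 0 = false)
    (hpr : ∀ n, p n = false → lexLt (shift^[n] p) r) (N : ℕ) :
    ∃ k, N ≤ k ∧ glue p k r ∈ lexSubshift a b := by
  have step : ∀ q ∈ lexSubshift a b, ∀ k, (∀ i < k, p i = q i) → p k < q k →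
      glue p k r ∈ lexSubshift a b ∧ p k = false := by
    intro q hq k hk hlt
    have hpk : p k = false := by revert hlt; cases p k <;> cases q k <;> simp
    have hqk : q k = true := by revert hlt; cases p k <;> cases q k <;> simp
    exact ⟨glue_mem_lexSubshift hp hq hr hk hqk hr0 (Or.inl (hpr k hpk)), hpk⟩
  have main : ∃ k, N ≤ k ∧ glue p k r ∈ lexSubshift a b ∧ p k = false := by
    induction N with
    | zero =>
      obtain ⟨k, hk, hlt⟩ := hpq
      exact ⟨k, Nat.zero_le _, step q hq k hk hlt⟩
    | succ N ih =>
      obtain ⟨k, hNk, hmem, hpk⟩ := ih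
      have hagree : ∀ i < k, p i = glue p k r i := fun i hi => by simp [glue, hi]
      have hlt : lexLt p (glue p k r) := by
        rw [← lexLt_shift_iff hagree]
        exact (shift_glue p r k 0).symm ▸ hpr k hpk
      obtain ⟨l, hl, hltl⟩ := hlt
      refine ⟨l, ?_, step _ hmem l hl hltl⟩
      by_contra hc
      rcases lt_or_ge l k with h | h
      · exact hltl.ne (hagree l h)
      · obtain rfl : l = k := by omega
        rw [hpk] at hltl
        simp [glue, hr0] at hltl
  obtain ⟨k, h1, h2, -⟩ := main
  exact ⟨k, h1, h2⟩

/-! ### Trapping -/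

/-- `z` lies in `A` and is squeezed between two tails of block concatenations. -/
def Trapped (A : Set Seq) (b c : ℕ → List Bool) (z : Seq) : Prop :=
  z ∈ A ∧ ∃ j k, lexLe (concatTail c j) z ∧ lexLe z (concatTail b k)

section Trapped

variable {α β : Seq} {ω ν : List Bool} {b c : ℕ → List Bool}

lemma lexLe_squeeze_wordThen {w : List Bool} {x y z : Seq} (h1 : lexLe (wordThen w x) z)
    (h2 : lexLe z (wordThen w y)) :
    (∀ i < w.length, z i = w.getD i false) ∧ lexLe x (shift^[w.length] z) ∧
      lexLe (shift^[w.length] z) y := by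
  have h : ∀ i < w.length, z i = w.getD i false := fun i hi => by
    rw [eq_of_lexLe_of_lexLe h1 h2 (wordThen_agree w x y) i hi, wordThen_apply_of_lt _ hi]
  rw [eq_wordThen_shift h, lexLe_wordThen_iff] at h1 h2
  exact ⟨h, h1, h2⟩

lemma Trapped.of_head_false (hb : ∀ k, 0 < (b k).length) (hc : ∀ k, 0 < (c k).length)
    (hν0 : ν.getD 0 false = true) (hcm : ∀ k, c k = ω ∨ c k = ν)
    (hb0 : b 0 = ω) (hα : consSeq false α = concatSeq b) {z : Seq}
    (h : Trapped (lexSubshift α β) b c z) (hz : z 0 = false) :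
    (∀ i < ω.length, z i = ω.getD i false) ∧
      Trapped (lexSubshift α β) b c (shift^[ω.length] z) := by
  obtain ⟨hmem, j, k, hj, hk⟩ := h
  have hcj : c j = ω := by
    refine (hcm j).resolve_right fun hν => ?_
    have := hj.head_eq_false hz
    rw [concatTail_eq_wordThen hc, wordThen_apply_of_lt _ (hc j), hν, hν0] at this
    simp at this
  have hz0 : lexLe z (concatTail b 0) := by
    change lexLe z (concatSeq b)
    rw [← hα]
    refine lexLe_of_mem_lexSubshift (b := β) ?_ (by simp [hz, consSeq])
    rwa [shift_consSeq]
  rw [concatTail_eq_wordThen hc, hcj] at hj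
  rw [concatTail_eq_wordThen hb, hb0] at hz0
  obtain ⟨h1, h2, h3⟩ := lexLe_squeeze_wordThen hj hz0
  exact ⟨h1, shift_iterate_mem_lexSubshift hmem _, _, _, h2, h3⟩

lemma Trapped.of_head_true (hb : ∀ k, 0 < (b k).length) (hc : ∀ k, 0 < (c k).length)
    (hω0 : ω.getD 0 false = false) (hbm : ∀ k, b k = ω ∨ b k = ν)
    (hc0 : c 0 = ν) (hβ : consSeq true β = concatSeq c) {z : Seq}
    (h : Trapped (lexSubshift α β) b c z) (hz : z 0 = true) :
    (∀ i < ν.length, z i = ν.getD i false) ∧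
      Trapped (lexSubshift α β) b c (shift^[ν.length] z) := by
  obtain ⟨hmem, j, k, hj, hk⟩ := h
  have hbk : b k = ν := by
    refine (hbm k).resolve_left fun hω => ?_
    have := hk.head_eq_true hz
    rw [concatTail_eq_wordThen hb, wordThen_apply_of_lt _ (hb k), hω, hω0] at this
    simp at this
  have hz0 : lexLe (concatTail c 0) z := by
    change lexLe (concatSeq c) z
    rw [← hβ]
    refine lexLe_of_mem_lexSubshift' (a := α) ?_ (by simp [hz, consSeq])
    rwa [shift_consSeq]
  rw [concatTail_eq_wordThen hb, hbk] at hk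
  rw [concatTail_eq_wordThen hc, hc0] at hz0
  obtain ⟨h1, h2, h3⟩ := lexLe_squeeze_wordThen hz0 hk
  exact ⟨h1, shift_iterate_mem_lexSubshift hmem _, _, _, h2, h3⟩

/-- If both kinds of first symbols lead from `T` back to `T`, then every window of length
`ℓ(ω) + ℓ(ν)` contains a return time to `T`. -/
lemma exists_return {T : Seq → Prop} (hω : 0 < ω.length) (hν : 0 < ν.length)
    (h0 : ∀ z, T z → z 0 = false → T (shift^[ω.length] z))
    (h1 : ∀ z, T z → z 0 = true → T (shift^[ν.length] z)) {z : Seq} (hz : T z) (m : ℕ) :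
    ∃ r < ω.length + ν.length, T (shift^[m + r] z) := by
  induction m with
  | zero => exact ⟨0, by omega, hz⟩
  | succ m ih =>
    obtain ⟨r, hr, hT⟩ := ih
    obtain _ | r := r
    · cases hm : shift^[m] z 0 with
      | false =>
        have := h0 _ hT hm
        rw [shift_iterate_add] at this
        refine ⟨ω.length - 1, by omega, ?_⟩
        convert this using 2
        omega
      | true =>
        have := h1 _ hT hm
        rw [shift_iterate_add] at this
        refine ⟨ν.length - 1, by omega, ?_⟩
        convert this using 2
        omega
    · refine ⟨r, by omega, ?_⟩
      rwa [show m + 1 + r = m + (r + 1) by omega]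

/-- A concatenation of blocks starting with `w`, as long as it agrees with a sequence on the
outer side of the hole bounded by `w^∞`, consists of copies of `w` only. -/
lemma agree_periodicSeq {T S : Seq → Prop} {w : List Bool} {a : Bool} (hw : 0 < w.length)
    (hT : ∀ z, T z → z 0 = a → (∀ i < w.length, z i = w.getD i false) ∧ T (shift^[w.length] z))
    (hS : ∀ y, S y → S (shift^[w.length] y))
    (hSw : ∀ y, S y → y 0 = a → (∀ i < w.length, y i = w.getD i false) → y w.length = a)
    (n : ℕ) {y z : Seq} (hz : T z) (hy : S y) (ha : z 0 = a) (hyz : ∀ i < n, z i = y i) :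
    ∀ i < n, z i = periodicSeq w i := by
  induction n using Nat.strong_induction_on generalizing y z with
  | _ n ih =>
    obtain ⟨h1, h2⟩ := hT z hz ha
    intro i hi
    by_cases hiw : i < w.length
    · rw [h1 i hiw, periodicSeq_apply_of_lt hiw]
    · have hya : y w.length = a := hSw y hy (by rw [← hyz 0 (by omega), ha]) fun j hj => by
        rw [← hyz j (by omega), h1 j hj]
      have := ih (n - w.length) (by omega) h2 (hS y hy)
        (by rw [shift_iterate_apply, Nat.add_zero, hyz _ (by omega), hya])
        (fun j hj => by
          rw [shift_iterate_apply, shift_iterate_apply, hyz _ (by omega)])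
        (i - w.length) (by omega)
      rw [shift_iterate_apply, Nat.add_sub_cancel' (by omega)] at this
      rw [this, ← periodicSeq_length_mul_add w 1 (i - w.length)]
      congr 1
      omega

end Trapped

/-! ### Occurrences of words -/

lemma occursIn_iff {w : List Bool} {x : Seq} :
    occursIn w x ↔ ∃ i, ∀ j < w.length, x (i + j) = w.getD j false := by
  refine exists_congr fun i => ⟨fun h j hj => ?_, fun h => ?_⟩
  · have hj' : w[j]? = (List.ofFn fun j : Fin w.length => x (i + (j : ℕ)))[j]? := by rw [← h]
    rw [List.getD_eq_getElem?_getD, hj', List.getElem?_ofFn]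
    simp [hj]
  · refine List.ext_getElem (by simp) fun j hj hj' => ?_
    rw [List.getElem_ofFn, h j hj, List.getD_eq_getElem _ _ hj]


/-- The bounds on the orbits of `ω^∞` and `ν^∞` that a renormalisation provides. -/
structure OrbitBounds (ω ν : List Bool) : Prop where
  length_left : 0 < ω.length
  length_right : 0 < ν.length
  left_zero : periodicSeq ω 0 = false
  left_one : periodicSeq ω 1 = true
  right_zero : periodicSeq ν 0 = true
  right_one : periodicSeq ν 1 = false
  left_le : ∀ i, periodicSeq ω i = false → lexLe (shift^[i] (periodicSeq ω)) (periodicSeq ω)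
  le_right : ∀ i, periodicSeq ν i = true → lexLe (periodicSeq ν) (shift^[i] (periodicSeq ν))
  right_lt : ∀ i, periodicSeq ν i = false → lexLt (shift^[i] (periodicSeq ν)) (periodicSeq ω)
  lt_left : ∀ i, periodicSeq ω i = true → lexLt (periodicSeq ν) (shift^[i] (periodicSeq ω))

lemma OrbitBounds.of_renormalisableBy {α β : Seq} {ω ν : List Bool}
    (hα0 : α 0 = true) (hβ0 : β 0 = false) (hren : RenormalisableBy α β ω ν)
    (hlen : 4 < ω.length + ν.length) : OrbitBounds ω ν := by
  obtain ⟨hω, hν, hmax, hmin, -, ⟨b, hb0, hb1, hb, hbα⟩, ⟨c, hc0, hc1, hc, hcβ⟩⟩ := hren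
  have hωl : 0 < ω.length := by
    rcases ω with _ | _
    · simp [isZeroMax] at hω
    · simp
  have hνl : 0 < ν.length := by
    rcases ν with _ | _
    · simp [isOneMin] at hν
    · simp
  have hbl : ∀ k, 0 < (b k).length := fun k => by rcases hb k with h | h <;> rwa [h]
  have hcl : ∀ k, 0 < (c k).length := fun k => by rcases hc k with h | h <;> rwa [h]
  have hω0 : periodicSeq ω 0 = false := by
    rcases ω with _ | ⟨a, t⟩
    · simp at hωl
    · simpa [periodicSeq, isZeroMax] using hω.1
  have hν0 : periodicSeq ν 0 = true := by
    rcases ν with _ | ⟨a, t⟩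
    · simp at hνl
    · simpa [periodicSeq, isOneMin] using hν.1
  have right_lt : ∀ i, periodicSeq ν i = false →
      lexLt (shift^[i] (periodicSeq ν)) (periodicSeq ω) := fun i hi => by
    obtain ⟨v, hv, hle⟩ := exists_isZeroMaxOf hνl hi
    exact hle.trans_lt (hmax v hv)
  have lt_left : ∀ i, periodicSeq ω i = true →
      lexLt (periodicSeq ν) (shift^[i] (periodicSeq ω)) := fun i hi => by
    obtain ⟨u, hu, hle⟩ := exists_isOneMinOf hωl hi
    exact (hmin u hu).trans_le hle
  have hω1 : 1 < ω.length → periodicSeq ω 1 = true := fun h => by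
    have h1 := congrFun hbα 1
    rw [concatSeq_eq_wordThen hbl, hb0, wordThen_apply_of_lt _ h] at h1
    rw [periodicSeq_apply_of_lt h, ← h1]
    simpa [consSeq] using hα0
  have hν1 : 1 < ν.length → periodicSeq ν 1 = false := fun h => by
    have h1 := congrFun hcβ 1
    rw [concatSeq_eq_wordThen hcl, hc0, wordThen_apply_of_lt _ h] at h1
    rw [periodicSeq_apply_of_lt h, ← h1]
    simpa [consSeq] using hβ0
  have hω2 : 1 < ω.length := by
    by_contra hc
    have hω1 : ω.length = 1 := by omega
    obtain ⟨k, -, hk⟩ := right_lt 1 (hν1 (by omega))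
    have : periodicSeq ω k = false := by
      rw [← hω0, periodicSeq, periodicSeq, hω1, Nat.mod_one, Nat.mod_one]
    rw [this] at hk
    exact not_lt_bot hk
  have hν2 : 1 < ν.length := by
    by_contra hc
    have hν1 : ν.length = 1 := by omega
    obtain ⟨k, -, hk⟩ := lt_left 1 (hω1 hω2)
    have : periodicSeq ν k = true := by
      rw [← hν0, periodicSeq, periodicSeq, hν1, Nat.mod_one, Nat.mod_one]
    rw [this] at hk
    exact absurd hk (by simp)
  exact ⟨hωl, hνl, hω0, hω1 hω2, hν0, hν1 hν2, fun i => hω.shift_lexLe,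
    fun i => hν.lexLe_shift, right_lt, lt_left⟩

/-- The sequences in `[σ(ν^∞), σ(ω^∞)]` whose orbits avoid the hole `(ω^∞, ν^∞)`. -/
abbrev innerSubshift (ω ν : List Bool) : Set Seq :=
  lexSubshift (shift (periodicSeq ω)) (shift (periodicSeq ν))

namespace OrbitBounds

variable {ω ν : List Bool} (h : OrbitBounds ω ν)

include h

lemma left_mem : periodicSeq ω ∈ innerSubshift ω ν := fun n =>
  ⟨lexLe_shift_of_hole h.right_zero (Or.inl (h.right_lt 1 h.right_one))
    (fun i hi => Or.inl (h.lt_left i hi)) n,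
   shift_lexLe_of_hole h.left_zero (Or.inl (lexLt_of_head h.left_zero h.left_one)) h.left_le n⟩

lemma right_mem : periodicSeq ν ∈ innerSubshift ω ν := fun n =>
  ⟨lexLe_shift_of_hole h.right_zero (Or.inl (lexLt_of_head h.right_one h.right_zero))
    h.le_right n,
   shift_lexLe_of_hole h.left_zero (Or.inl (h.lt_left 1 h.left_one))
    (fun i hi => Or.inl (h.right_lt i hi)) n⟩

lemma exists_glue_mem_inner (N : ℕ) :
    ∃ k, N ≤ k ∧ glue (periodicSeq ν) k (periodicSeq ω) ∈ innerSubshift ω ν :=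
  exists_glue_mem h.right_mem (shift_iterate_mem_lexSubshift h.left_mem 1) h.left_mem
    (h.lt_left 1 h.left_one) h.left_zero h.right_lt N

lemma head_after_left {y : Seq} (hy : y ∈ innerSubshift ω ν) (hy0 : y 0 = false)
    (hyw : ∀ i < ω.length, y i = ω.getD i false) : y ω.length = false := by
  have hle := lexLe_of_mem_lexSubshift hy (hy0.trans h.left_zero.symm)
  rw [eq_wordThen_shift hyw, ← wordThen_periodicSeq ω, lexLe_wordThen_iff] at hle
  simpa [shift_iterate_apply] using hle.head_eq_false h.left_zero

lemma head_after_right {y : Seq} (hy : y ∈ innerSubshift ω ν) (hy0 : y 0 = true)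
    (hyw : ∀ i < ν.length, y i = ν.getD i false) : y ν.length = true := by
  have hle := lexLe_of_mem_lexSubshift' hy (h.right_zero.trans hy0.symm)
  rw [eq_wordThen_shift hyw, ← wordThen_periodicSeq ν, lexLe_wordThen_iff] at hle
  simpa [shift_iterate_apply] using hle.head_eq_true h.right_zero

lemma exists_uniform_ne_left :
    ∃ K, ∀ i, ∃ j < K, periodicSeq ν j ≠ periodicSeq ω (i + j) := by
  refine exists_uniform_ne h.length_left fun i hi => ?_
  have h0 : periodicSeq ω i = true := by
    rw [← h.right_zero, hi, shift_iterate_apply, Nat.add_zero]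
  have := h.lt_left i h0
  rw [← hi] at this
  exact lexLt_irrefl _ this

lemma exists_uniform_ne_right :
    ∃ K, ∀ i, ∃ j < K, periodicSeq ω j ≠ periodicSeq ν (i + j) := by
  refine exists_uniform_ne h.length_right fun i hi => ?_
  have h0 : periodicSeq ν i = false := by
    rw [← h.left_zero, hi, shift_iterate_apply, Nat.add_zero]
  have := h.right_lt i h0
  rw [← hi] at this
  exact lexLt_irrefl _ this

/-- Some sequence of the inner subshift has a prefix that is no factor of a trapped sequence. -/
lemma exists_mem_inner_not_agree {T : Seq → Prop}
    (h0 : ∀ z, T z → z 0 = false →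
      (∀ i < ω.length, z i = ω.getD i false) ∧ T (shift^[ω.length] z))
    (h1 : ∀ z, T z → z 0 = true →
      (∀ i < ν.length, z i = ν.getD i false) ∧ T (shift^[ν.length] z)) :
    ∃ x ∈ innerSubshift ω ν, ∃ n, ∀ z, T z → ∀ m, ∃ i < n, z (m + i) ≠ x i := by
  obtain ⟨K, hK⟩ := h.exists_uniform_ne_left
  obtain ⟨K', hK'⟩ := h.exists_uniform_ne_right
  obtain ⟨k, hk, hx⟩ := h.exists_glue_mem_inner ((ω.length + ν.length) * ν.length + K)
  have hωl := h.length_left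
  have hνl := h.length_right
  refine ⟨_, hx, k + K + K', fun z hz m => ?_⟩
  by_contra! hcon
  obtain ⟨r, hr, hT⟩ := exists_return hωl hνl (fun z hz ha => (h0 z hz ha).2)
    (fun z hz ha => (h1 z hz ha).2) hz m
  have hM : ω.length + ν.length ≤ (ω.length + ν.length) * ν.length :=
    Nat.le_mul_of_pos_right _ hνl
  generalize hM' : ω.length + ν.length = M at *
  have hagree : ∀ i < k + K + K' - r, shift^[m + r] z i =
      shift^[r] (glue (periodicSeq ν) k (periodicSeq ω)) i := fun i hi => by
    rw [shift_iterate_apply, shift_iterate_apply, ← hcon _ (by omega), Nat.add_assoc]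
  have hS := fun y hy => shift_iterate_mem_lexSubshift (α := shift (periodicSeq ω))
    (β := shift (periodicSeq ν)) (x := y) hy
  cases ha : shift^[m + r] z 0 with
  | false =>
    have hper := agree_periodicSeq (S := (· ∈ innerSubshift ω ν)) hωl h0 (fun y hy => hS y hy _)
      (fun y => h.head_after_left) _ hT (hS _ hx r) ha hagree
    obtain ⟨j, hj, hne⟩ := hK (M * ν.length - r)
    apply hne
    have e1 := hagree (M * ν.length - r + j) (by omega)
    rw [hper _ (by omega), shift_iterate_apply, glue, if_pos (by omega),
      show r + (M * ν.length - r + j) = M * ν.length + j by omega,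
      periodicSeq_length_mul_add] at e1
    exact e1.symm
  | true =>
    have hper := agree_periodicSeq (S := (· ∈ innerSubshift ω ν)) hνl h1 (fun y hy => hS y hy _)
      (fun y => h.head_after_right) _ hT (hS _ hx r) ha hagree
    obtain ⟨j, hj, hne⟩ := hK' (k - r)
    apply hne
    have e1 := hagree (k - r + j) (by omega)
    rw [hper _ (by omega), shift_iterate_apply, glue, if_neg (by omega),
      show r + (k - r + j) - k = j by omega] at e1
    exact e1.symm

end OrbitBounds

lemma left_mem_lexSubshift {α β : Seq} (hLW : inLW α β) : α ∈ lexSubshift α β := by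
  intro n
  obtain _ | n := n
  · have hβ := hLW.2.1.1
    exact ⟨Or.inl (lexLt_of_head (by simpa [mirror] using hβ) hLW.1.1), Or.inr rfl⟩
  · exact ⟨(hLW.2.2 _ (by omega)).1, hLW.1.2 _ (by omega)⟩

lemma exists_block_change {ω ν : List Bool} {b : ℕ → List Bool} (hbl : ∀ k, 0 < (b k).length)
    (hb0 : b 0 = ω) (hb1 : b 1 = ν) (hb : ∀ k, b k = ω ∨ b k = ν)
    (hne : concatSeq b ≠ wordThen ω (periodicSeq ν)) :
    ∃ k, b (k + 1) = ν ∧ b (k + 2) = ω := by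
  by_contra! hcon
  apply hne
  have hall : ∀ k, b (k + 1) = ν := fun k => by
    induction k with
    | zero => exact hb1
    | succ k ih => exact (hb _).resolve_left (hcon k ih)
  have h12 : concatTail b 2 = concatTail b 1 := by
    simp only [concatTail]
    congr 1
    funext i
    exact (hall (i + 1)).trans (hall i).symm
  have h1 := concatTail_eq_wordThen hbl 1
  rw [h12, hb1] at h1
  have h0 := concatTail_eq_wordThen hbl 0
  rw [eq_periodicSeq (hb1 ▸ hbl 1) h1, hb0] at h0
  exact h0

/-- if (α,β) ∈ LW is renormalisable by finite words ω, ν with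
ℓ(ω) + ℓ(ν) > 4, 0α ≠ ων^∞ and 1β ≠ νω^∞, then Σ_{(α,β)} is not topologically
transitive. -/
theorem statement16 (α β : Seq) (hLW : inLW α β) (ω ν : List Bool)
    (hren : RenormalisableBy α β ω ν)
    (hlen : 4 < ω.length + ν.length)
    (hne1 : consSeq false α ≠ wordThen ω (periodicSeq ν))
    (hne2 : consSeq true β ≠ wordThen ν (periodicSeq ω)) :
    ¬ TransitiveShift (lexSubshift α β) := by
  intro htrans
  have hα0 : α 0 = true := hLW.1.1
  have hβ0 : β 0 = false := by simpa [mirror] using hLW.2.1.1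
  have h := OrbitBounds.of_renormalisableBy hα0 hβ0 hren hlen
  obtain ⟨-, -, -, -, -, ⟨b, hb0, hb1, hb, hbα⟩, ⟨c, hc0, hc1, hc, hcβ⟩⟩ := hren
  have hωl := h.length_left
  have hνl := h.length_right
  have hbl : ∀ k, 0 < (b k).length := fun k => by rcases hb k with h | h <;> rwa [h]
  have hcl : ∀ k, 0 < (c k).length := fun k => by rcases hc k with h | h <;> rwa [h]
  have hω0 : ω.getD 0 false = false := by rw [← periodicSeq_apply_of_lt hωl, h.left_zero]
  have hν0 : ν.getD 0 false = true := by rw [← periodicSeq_apply_of_lt hνl, h.right_zero]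
  have hsub : innerSubshift ω ν ⊆ lexSubshift α β := by
    apply lexSubshift_mono
    · have hlt : lexLe (periodicSeq ω) (consSeq false α) := by
        rw [hbα, concatSeq_eq_wordThen hbl, hb0, ← wordThen_periodicSeq ω, lexLe_wordThen_iff]
        refine Or.inl (lexLt_of_head h.left_zero ?_)
        rw [concatSeq_eq_wordThen fun k => hbl (k + 1),
          wordThen_apply_of_lt _ (hbl 1), hb1, hν0]
      have := (lexLe_tail_iff (by simp [consSeq, h.left_zero])).2 hlt
      rwa [shift_consSeq] at this
    · have hlt : lexLe (consSeq true β) (periodicSeq ν) := by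
        rw [hcβ, concatSeq_eq_wordThen hcl, hc0, ← wordThen_periodicSeq ν, lexLe_wordThen_iff]
        refine Or.inl (lexLt_of_head ?_ h.right_zero)
        rw [concatSeq_eq_wordThen fun k => hcl (k + 1),
          wordThen_apply_of_lt _ (hcl 1), hc1, hω0]
      have := (lexLe_tail_iff (by simp [consSeq, h.right_zero])).2 hlt
      rwa [shift_consSeq] at this
  have h0 := fun z hz ha => Trapped.of_head_false (β := β) hbl hcl hν0 hc hb0 hbα (z := z) hz ha
  have h1 := fun z hz ha => Trapped.of_head_true (α := α) hbl hcl hω0 hb hc0 hcβ (z := z) hz ha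
  obtain ⟨x, hx, n, hxn⟩ := h.exists_mem_inner_not_agree h0 h1
  obtain ⟨k, hk1, hk2⟩ := exists_block_change hbl hb0 hb1 hb (hbα ▸ hne1)
  have hu : ν ++ [false] ∈ Lang (lexSubshift α β) := by
    obtain ⟨t, ht, hshift⟩ := exists_shift_eq_concatTail hbl (k + 1)
    obtain ⟨t, rfl⟩ : ∃ s, t = s + 1 := ⟨t - 1, by omega⟩
    rw [← hbα, Function.iterate_succ_apply, shift_consSeq,
      concatTail_eq_wordThen hbl, concatTail_eq_wordThen hbl, hk1, hk2] at hshift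
    refine ⟨α, left_mem_lexSubshift hLW, occursIn_iff.2 ⟨t, fun j hj => ?_⟩⟩
    rw [← shift_iterate_apply α t j, ← hshift]
    by_cases hjν : j < ν.length
    · rw [wordThen_apply_of_lt _ hjν, List.getD_append _ _ _ _ hjν]
    · obtain rfl : j = ν.length := by simp at hj; omega
      simp only [wordThen, lt_irrefl, if_false, Nat.sub_self, hωl, if_true, hω0]
      simp
  have hv : List.ofFn (fun i : Fin n => x i) ∈ Lang (lexSubshift α β) := by
    refine ⟨x, hsub hx, occursIn_iff.2 ⟨0, fun j hj => ?_⟩⟩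
    rw [List.getD_eq_getElem _ _ hj, List.getElem_ofFn, Nat.zero_add]
  obtain ⟨t, -, y, hy, hocc⟩ := htrans _ hu _ hv
  obtain ⟨i, hi⟩ := occursIn_iff.1 hocc
  simp only [List.length_append, List.length_ofFn, List.length_singleton] at hi
  have hi1 : ∀ j < ν.length, shift^[i] y j = ν.getD j false := fun j hj => by
    rw [shift_iterate_apply, hi j (by omega), List.append_assoc, List.append_assoc,
      List.getD_append _ _ _ _ hj]
  have hi2 : shift^[ν.length] (shift^[i] y) 0 = false := by
    rw [shift_iterate_apply, shift_iterate_apply, hi _ (by omega)]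
    simp
  have hyi := shift_iterate_mem_lexSubshift hy i
  have hcy : lexLe (concatTail c 0) (shift^[i] y) := by
    change lexLe (concatSeq c) _
    rw [← hcβ]
    refine lexLe_of_mem_lexSubshift' (a := α) (by rwa [shift_consSeq]) ?_
    rw [hi1 0 hνl, hν0]
    simp [consSeq]
  have hcy' : lexLe (concatTail c 1) (shift^[ν.length] (shift^[i] y)) := by
    rwa [concatTail_eq_wordThen hcl, hc0, eq_wordThen_shift hi1, lexLe_wordThen_iff] at hcy
  have hyν := shift_iterate_mem_lexSubshift hyi ν.length
  have hyb : lexLe (shift^[ν.length] (shift^[i] y)) (concatTail b 0) := by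
    change lexLe _ (concatSeq b)
    rw [← hbα]
    refine lexLe_of_mem_lexSubshift (b := β) (by rwa [shift_consSeq]) ?_
    rw [hi2]
    simp [consSeq]
  obtain ⟨j, hj, hne⟩ := hxn _ ⟨hyν, 1, 0, hcy', hyb⟩ (1 + t.length)
  apply hne
  rw [shift_iterate_apply, shift_iterate_apply, hi _ (by omega),
    List.getD_append_right _ _ _ _ (by simp; omega)]
  simp only [List.length_append, List.length_singleton]
  rw [show ν.length + (1 + t.length + j) - (ν.length + 1 + t.length) = j by omega,
    List.getD_eq_getElem _ _ (by simpa using hj), List.getElem_ofFn]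

end DoublingHole
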